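/- arXiv:1511.06232 — 2 statements merged into one kernel-verified Lean document; each statement's English description precedes it below -/
import Mathlib

section
/- Let E be a separable real Banach space and m a finite Borel measure on E. Then the ℂ-linear span of the family of functions x ↦ exp(i·ξ(x)), where ξ ranges over the continuous real-linear functionals on E, is dense in the complex Lebesgue space L²(E, m; ℂ). -/
open MeasureTheory

lemma aux_real
    {E : Type*} [NormedAddCommGroup E] [NormedSpace ℝ E] [CompleteSpace E]
    [TopologicalSpace.SeparableSpace E]
    [MeasurableSpace E] [BorelSpace E]
    (m : Measure E) [IsFiniteMeasure m] (u : E → ℝ) (hu : Integrable u m)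
    (h : ∀ ξ : E →L[ℝ] ℝ, ∫ x, Complex.exp (Complex.I * (ξ x : ℂ)) * (u x : ℂ) ∂m = 0) :
    u =ᵐ[m] 0 := by
  haveI : SecondCountableTopology E := UniformSpace.secondCountable_of_separable E
  have f1 : IsFiniteMeasure (m.withDensity fun x => ENNReal.ofReal (u x)) :=
    isFiniteMeasure_withDensity_ofReal hu.2
  have f2 : IsFiniteMeasure (m.withDensity fun x => ENNReal.ofReal (-u x)) :=
    isFiniteMeasure_withDensity_ofReal hu.neg.2
  have m1 : AEMeasurable (fun x => ENNReal.ofReal (u x)) m := hu.aemeasurable.ennreal_ofReal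
  have m2 : AEMeasurable (fun x => ENNReal.ofReal (-u x)) m := hu.neg.aemeasurable.ennreal_ofReal
  have key : (m.withDensity fun x => ENNReal.ofReal (u x)) =
      (m.withDensity fun x => ENNReal.ofReal (-u x)) := by
    apply Measure.ext_of_charFunDual
    ext ξ
    have hexp : AEStronglyMeasurable (fun x => Complex.exp ((ξ x : ℂ) * Complex.I)) m := by
      apply Continuous.aestronglyMeasurable
      fun_prop
    have hb : ∀ x, ‖Complex.exp ((ξ x : ℂ) * Complex.I)‖ ≤ 1 := fun x =>
      (Complex.norm_exp_ofReal_mul_I _).le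
    have i1 : Integrable (fun x => Complex.exp ((ξ x : ℂ) * Complex.I) *
        ((max (u x) 0 : ℝ) : ℂ)) m :=
      (hu.pos_part.ofReal).bdd_mul hexp (Filter.Eventually.of_forall hb)
    have i2 : Integrable (fun x => Complex.exp ((ξ x : ℂ) * Complex.I) *
        ((max (-u x) 0 : ℝ) : ℂ)) m :=
      (hu.neg_part.ofReal).bdd_mul hexp (Filter.Eventually.of_forall hb)
    rw [charFunDual_apply, charFunDual_apply,
      integral_withDensity_eq_integral_toReal_smul₀ m1 (by simp),
      integral_withDensity_eq_integral_toReal_smul₀ m2 (by simp), ← sub_eq_zero]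
    simp only [ENNReal.toReal_ofReal', Complex.real_smul, mul_comm (Complex.ofReal (max _ _))]
    rw [← integral_sub i1 i2, ← h ξ]
    congr 1 with x
    rw [← mul_sub, ← Complex.ofReal_sub, mul_comm Complex.I]
    congr 2
    rcases le_total 0 (u x) with h0 | h0
    · rw [max_eq_left h0, max_eq_right (by linarith)]; ring
    · rw [max_eq_right h0, max_eq_left (by linarith)]; ring
  have := (withDensity_eq_iff m1 m2 (by
    have := f1.measure_univ_lt_top
    rw [withDensity_apply _ MeasurableSet.univ, Measure.restrict_univ] at this
    exact this.ne)).1 key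
  filter_upwards [this] with x hx
  rcases le_total 0 (u x) with h0 | h0
  · rw [ENNReal.ofReal_of_nonpos (by linarith : -u x ≤ 0), ENNReal.ofReal_eq_zero] at hx
    exact le_antisymm hx h0
  · rw [ENNReal.ofReal_of_nonpos h0, eq_comm, ENNReal.ofReal_eq_zero] at hx
    exact le_antisymm h0 (neg_nonpos.1 hx)

/-- **Density of trigonometric polynomials in `L²(E, m; ℂ)`.**
Let `E` be a separable real Banach space and `m` a finite Borel measure on `E`. The ℂ-linear
span of the characters `x ↦ exp(i ξ x)`, `ξ` ranging over continuous real-linear functionals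
on `E`, is dense in `L²(E, m; ℂ)`. -/
theorem span_characters_dense_L2
    (E : Type*) [NormedAddCommGroup E] [NormedSpace ℝ E] [CompleteSpace E]
    [TopologicalSpace.SeparableSpace E]
    [MeasurableSpace E] [BorelSpace E]
    (m : Measure E) [IsFiniteMeasure m] :
    Dense (Submodule.span ℂ
      {f : Lp ℂ 2 m | ∃ ξ : E →L[ℝ] ℝ,
        (f : E → ℂ) =ᵐ[m] fun x => Complex.exp (Complex.I * (ξ x : ℂ))} : Set (Lp ℂ 2 m)) := by
  haveI : SecondCountableTopology E := UniformSpace.secondCountable_of_separable E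
  rw [Submodule.dense_iff_topologicalClosure_eq_top, Submodule.topologicalClosure_eq_top_iff,
    Submodule.eq_bot_iff]
  intro g hg
  have hgi : Integrable (g : E → ℂ) m := (Lp.memLp g).integrable (by norm_num)
  have hexp : ∀ ξ : E →L[ℝ] ℝ,
      AEStronglyMeasurable (fun x => Complex.exp (Complex.I * (ξ x : ℂ))) m := by
    intro ξ
    apply Continuous.aestronglyMeasurable
    fun_prop
  have hn : ∀ (ξ : E →L[ℝ] ℝ) x, ‖Complex.exp (Complex.I * (ξ x : ℂ))‖ ≤ 1 := fun ξ x => by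
    rw [mul_comm]; exact (Complex.norm_exp_ofReal_mul_I _).le
  have hconj : ∀ (ξ : E →L[ℝ] ℝ) x, (starRingEnd ℂ) (Complex.exp (Complex.I * (ξ x : ℂ))) =
      Complex.exp (Complex.I * ((-ξ) x : ℂ)) := fun ξ x => by
    rw [← Complex.exp_conj]; simp
  have h1 : ∀ ξ : E →L[ℝ] ℝ, ∫ x, Complex.exp (Complex.I * (ξ x : ℂ)) * g x ∂m = 0 := by
    intro ξ
    have hmem : MemLp (fun x => Complex.exp (Complex.I * ((-ξ) x : ℂ))) 2 m :=
      MemLp.of_bound (hexp (-ξ)) 1 (Filter.Eventually.of_forall (hn (-ξ)))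
    have h0 := hg (hmem.toLp _) (Submodule.subset_span ⟨-ξ, hmem.coeFn_toLp⟩)
    rw [L2.inner_def] at h0
    rw [← h0]
    apply integral_congr_ae
    filter_upwards [hmem.coeFn_toLp] with x hx
    rw [hx, RCLike.inner_apply, hconj, neg_neg, mul_comm]
  have h2 : ∀ ξ : E →L[ℝ] ℝ,
      ∫ x, Complex.exp (Complex.I * (ξ x : ℂ)) * (starRingEnd ℂ) (g x) ∂m = 0 := by
    intro ξ
    have := congrArg (starRingEnd ℂ) (h1 (-ξ))
    rw [← integral_conj, map_zero] at this
    rw [← this]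
    congr 1 with x
    rw [map_mul, hconj, neg_neg]
  have hci : Integrable (fun x => (starRingEnd ℂ) (g x)) m :=
    hgi.congr' (Complex.continuous_conj.comp_aestronglyMeasurable hgi.1)
      (Filter.Eventually.of_forall fun x => by simp)
  have j1 := fun ξ => hgi.bdd_mul (hexp ξ) (Filter.Eventually.of_forall (hn ξ))
  have j2 := fun ξ => hci.bdd_mul (hexp ξ) (Filter.Eventually.of_forall (hn ξ))
  have hre := aux_real m (fun x => (g x).re) hgi.re (fun ξ => by
    have : ∫ x, (1 / 2 : ℂ) * (Complex.exp (Complex.I * (ξ x : ℂ)) * g x +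
        Complex.exp (Complex.I * (ξ x : ℂ)) * (starRingEnd ℂ) (g x)) ∂m = 0 := by
      rw [integral_const_mul, integral_add (j1 ξ) (j2 ξ), h1, h2]; simp
    rw [← this]
    congr 1 with x
    rw [Complex.re_eq_add_conj]; ring)
  have him := aux_real m (fun x => (g x).im) hgi.im (fun ξ => by
    have : ∫ x, (1 / (2 * Complex.I) : ℂ) * (Complex.exp (Complex.I * (ξ x : ℂ)) * g x -
        Complex.exp (Complex.I * (ξ x : ℂ)) * (starRingEnd ℂ) (g x)) ∂m = 0 := by
      rw [integral_const_mul, integral_sub (j1 ξ) (j2 ξ), h1, h2]; simp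
    rw [← this]
    congr 1 with x
    rw [Complex.im_eq_sub_conj]; ring)
  rw [Lp.eq_zero_iff_ae_eq_zero]
  filter_upwards [hre, him] with x a b
  exact Complex.ext a b
end

section
/- Let 𝓗 be a real Hilbert space, H ∈ (0,1), (Ω, ℱ, ℙ) a probability space, and X : 𝓗 → Ω → ℝ a Gaussian process, in the sense that for every n ∈ ℕ and every f : Fin n → 𝓗, the law on ℝⁿ of ω ↦ (X(f_i)(ω))_i is a Gaussian measure. Assume X is centered with E[X(f)] = 0 and covariance E[X(f)·X(g)] = ½(‖f‖^{2H} + ‖g‖^{2H} − ‖f − g‖^{2H}) for all f, g ∈ 𝓗. Then X satisfies: (SS1) for every a > 0, every n and every f : Fin n → 𝓗, the law on ℝⁿ of ω ↦ (a^{−H}·X(a·f_i)(ω))_i equals the law of ω ↦ (X(f_i)(ω))_i; and (SI1) for every map ψ : 𝓗 → 𝓗 of the form ψ(f) = U(f) + h with U a linear isometric equivalence of 𝓗 and h ∈ 𝓗, and every n and f : Fin n → 𝓗, the law of ω ↦ (X(ψ(f_i))(ω) − X(ψ(0))(ω))_i equals the law of ω ↦ (X(f_i)(ω) − X(0)(ω))_i.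 -/
open MeasureTheory

/-- A measure on `Fin n → ℝ` is Gaussian if all its one-dimensional continuous linear
projections are (possibly degenerate) Gaussian laws on `ℝ`. -/
def IsGaussianLaw {n : ℕ} (μ : Measure (Fin n → ℝ)) : Prop :=
  ∀ l : (Fin n → ℝ) →L[ℝ] ℝ, ∃ (c : ℝ) (v : NNReal),
    μ.map l = ProbabilityTheory.gaussianReal c v

open ProbabilityTheory in
lemma fdd_ext {Ω : Type*} [MeasurableSpace Ω] {P : Measure Ω} [IsProbabilityMeasure P] {n : ℕ}
    {Y Z : Fin n → Ω → ℝ}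
    (hY : HasGaussianLaw (fun ω => fun i => Y i ω) P)
    (hZ : HasGaussianLaw (fun ω => fun i => Z i ω) P)
    (hY0 : ∀ i, ∫ ω, Y i ω ∂P = 0) (hZ0 : ∀ i, ∫ ω, Z i ω ∂P = 0)
    (hc : ∀ i j, ∫ ω, Y i ω * Y j ω ∂P = ∫ ω, Z i ω * Z j ω ∂P) :
    Measure.map (fun ω => fun i => Y i ω) P = Measure.map (fun ω => fun i => Z i ω) P := by
  have key : ∀ (W : Fin n → Ω → ℝ), HasGaussianLaw (fun ω => fun i => W i ω) P →
      (∀ i, ∫ ω, W i ω ∂P = 0) → ∀ L : StrongDual ℝ (Fin n → ℝ),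
      (∫ ω, L (fun i => W i ω) ∂P = 0) ∧
      Var[fun ω => L (fun i => W i ω); P] =
        ∑ i, ∑ j, L (Pi.single i 1) * L (Pi.single j 1) * ∫ ω, W i ω * W j ω ∂P := by
    intro W hW hW0 L
    have hL : ∀ x : Fin n → ℝ, L x = ∑ i, L (Pi.single i 1) * x i := by
      intro x
      conv_lhs => rw [pi_eq_sum_univ' x]
      simp [map_sum, mul_comm]
    have h2 : ∀ i, MemLp (W i) 2 P := fun i => (hW.eval i).memLp_two
    have hi : ∀ i, Integrable (W i) P := fun i => (hW.eval i).integrable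
    have hm : ∫ ω, L (fun i => W i ω) ∂P = 0 := by
      rw [integral_congr_ae (Filter.Eventually.of_forall fun ω => hL (fun i => W i ω))]
      rw [integral_finsetSum _ (fun i _ => (hi i).const_mul _)]
      simp [integral_const_mul, hW0]
    refine ⟨hm, ?_⟩
    have ha : AEMeasurable (fun ω => L (fun i => W i ω)) P := (hW.map_fun L).aemeasurable
    rw [variance_of_integral_eq_zero ha hm]
    have hp : ∀ i j, Integrable (fun ω => W i ω * W j ω) P := fun i j =>
      (h2 i).integrable_mul (h2 j)
    have : ∀ ω, L (fun i => W i ω) ^ 2 =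
        ∑ i, ∑ j, L (Pi.single i 1) * L (Pi.single j 1) * (W i ω * W j ω) := by
      intro ω
      rw [hL, sq, Finset.sum_mul_sum]
      refine Finset.sum_congr rfl fun i _ => Finset.sum_congr rfl fun j _ => by ring
    simp_rw [this]
    rw [integral_finsetSum _ (fun i _ => integrable_finsetSum _
      (fun j _ => (hp i j).const_mul _))]
    refine Finset.sum_congr rfl fun i _ => ?_
    rw [integral_finsetSum _ (fun j _ => (hp i j).const_mul _)]
    simp [integral_const_mul]
  have := hY.isGaussian_map
  have := hZ.isGaussian_map
  apply Measure.ext_of_charFunDual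
  ext L
  rw [hY.charFunDual_map_eq_fun, hZ.charFunDual_map_eq_fun]
  rw [(key Y hY hY0 L).1, (key Z hZ hZ0 L).1, (key Y hY hY0 L).2, (key Z hZ hZ0 L).2]
  simp_rw [hc]

open ProbabilityTheory in
lemma IsGaussianLaw.hasLaw {Ω : Type*} [MeasurableSpace Ω] {P : Measure Ω} {n : ℕ}
    {Y : Ω → Fin n → ℝ} (h : IsGaussianLaw (Measure.map Y P)) : HasGaussianLaw Y P := by
  refine ⟨isGaussian_of_map_eq_gaussianReal fun L => ?_⟩
  obtain ⟨c, v, h⟩ := h L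
  exact ⟨c, v, h⟩

/-- **The `L²`-indexed fractional Brownian motion is self-similar and strongly increment
stationary.** A centered Gaussian process on a real Hilbert space `𝓗` with covariance
`½(‖f‖^{2H} + ‖g‖^{2H} − ‖f − g‖^{2H})` satisfies (SS1) `H`-self-similarity and (SI1) strong
`L²`-increment stationarity. -/
theorem L2fBm_is_selfSimilar_and_strongly_stationary
    (𝓗 : Type*) [NormedAddCommGroup 𝓗] [InnerProductSpace ℝ 𝓗] [CompleteSpace 𝓗]
    (H : ℝ) (hH : H ∈ Set.Ioo (0 : ℝ) 1)
    (Ω : Type*) [MeasurableSpace Ω] (ℙ : Measure Ω) [IsProbabilityMeasure ℙ]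
    (X : 𝓗 → Ω → ℝ)
    (hGauss : ∀ (n : ℕ) (f : Fin n → 𝓗),
      IsGaussianLaw (Measure.map (fun ω => fun i => X (f i) ω) ℙ))
    (hcent : ∀ f : 𝓗, ∫ ω, X f ω ∂ℙ = 0)
    (hcov : ∀ f g : 𝓗, ∫ ω, X f ω * X g ω ∂ℙ =
      (‖f‖ ^ (2 * H) + ‖g‖ ^ (2 * H) - ‖f - g‖ ^ (2 * H)) / 2) :
    (∀ a : ℝ, 0 < a → ∀ (n : ℕ) (f : Fin n → 𝓗),
      Measure.map (fun ω => fun i => a ^ (-H) * X (a • f i) ω) ℙ =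
        Measure.map (fun ω => fun i => X (f i) ω) ℙ) ∧
    (∀ (U : 𝓗 ≃ₗᵢ[ℝ] 𝓗) (h : 𝓗) (n : ℕ) (f : Fin n → 𝓗),
      Measure.map (fun ω => fun i => X (U (f i) + h) ω - X (U 0 + h) ω) ℙ =
        Measure.map (fun ω => fun i => X (f i) ω - X 0 ω) ℙ) := by
  have hG : ∀ (n : ℕ) (f : Fin n → 𝓗),
      ProbabilityTheory.HasGaussianLaw (fun ω => fun i => X (f i) ω) ℙ :=
    fun n f => (hGauss n f).hasLaw
  have h1 : ∀ f, ProbabilityTheory.HasGaussianLaw (X f) ℙ := fun f =>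
    (hG 1 (fun _ => f)).eval 0
  have hi : ∀ f, Integrable (X f) ℙ := fun f => (h1 f).integrable
  have hp : ∀ f g, Integrable (fun ω => X f ω * X g ω) ℙ := fun f g =>
    (h1 f).memLp_two.integrable_mul (h1 g).memLp_two
  have h0 : (0 : ℝ) ^ (2 * H) = 0 := Real.zero_rpow (by linarith [hH.1])
  refine ⟨fun a ha n f => ?_, fun U h n f => ?_⟩
  · refine fdd_ext (Y := fun i ω => a ^ (-H) * X (a • f i) ω) (Z := fun i ω => X (f i) ω)
      ?_ (hG n f) ?_ ?_ ?_
    · exact (hG n (fun i => a • f i)).fun_smul (a ^ (-H))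
    · intro i
      simp [integral_const_mul, hcent]
    · intro i
      exact hcent _
    · intro i j
      have e : ∀ ω, a ^ (-H) * X (a • f i) ω * (a ^ (-H) * X (a • f j) ω) =
          (a ^ (-H) * a ^ (-H)) * (X (a • f i) ω * X (a • f j) ω) := fun ω => by ring
      simp_rw [e]
      rw [integral_const_mul, hcov, hcov, ← smul_sub, norm_smul, norm_smul, norm_smul,
        Real.norm_of_nonneg ha.le, Real.mul_rpow ha.le (norm_nonneg _),
        Real.mul_rpow ha.le (norm_nonneg _), Real.mul_rpow ha.le (norm_nonneg _)]
      have : a ^ (-H) * a ^ (-H) * a ^ (2 * H) = 1 := by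
        rw [← Real.rpow_add ha, ← Real.rpow_add ha]
        ring_nf
        simp
      linear_combination ((‖f i‖ ^ (2 * H) + ‖f j‖ ^ (2 * H) - ‖f i - f j‖ ^ (2 * H)) / 2) * this
  · have hinc : ∀ (k : Fin n → 𝓗) (p : 𝓗),
        ProbabilityTheory.HasGaussianLaw (fun ω => fun i => X (k i) ω - X p ω) ℙ := by
      intro k p
      let L : (Fin (n + 1) → ℝ) →L[ℝ] (Fin n → ℝ) :=
        ContinuousLinearMap.pi fun i =>
          ContinuousLinearMap.proj (R := ℝ) (φ := fun _ : Fin (n + 1) => ℝ) i.succ -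
          ContinuousLinearMap.proj (R := ℝ) (φ := fun _ : Fin (n + 1) => ℝ) 0
      exact (hG (n + 1) (Fin.cons p k)).map_fun L
    have hmean : ∀ f g, ∫ ω, X f ω - X g ω ∂ℙ = 0 := by
      intro f g
      rw [integral_sub (hi f) (hi g), hcent, hcent, sub_zero]
    have hcv : ∀ f g p, ∫ ω, (X f ω - X p ω) * (X g ω - X p ω) ∂ℙ =
        (‖f - p‖ ^ (2 * H) + ‖g - p‖ ^ (2 * H) - ‖f - g‖ ^ (2 * H)) / 2 := by
      intro f g p
      have e : ∀ ω, (X f ω - X p ω) * (X g ω - X p ω) =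
          (X f ω * X g ω - X f ω * X p ω) - (X g ω * X p ω - X p ω * X p ω) :=
        fun ω => by ring
      simp_rw [e]
      have hd : ∀ a b c d, Integrable (fun ω => X a ω * X b ω - X c ω * X d ω) ℙ :=
        fun a b c d => (hp a b).sub (hp c d)
      rw [integral_sub (hd _ _ _ _) (hd _ _ _ _),
        integral_sub (hp _ _) (hp _ _), integral_sub (hp _ _) (hp _ _)]
      simp only [hcov, sub_self, norm_zero, h0]
      ring
    refine fdd_ext (Y := fun i ω => X (U (f i) + h) ω - X (U 0 + h) ω)
      (Z := fun i ω => X (f i) ω - X 0 ω) (hinc _ _) (hinc _ _)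
      (fun i => hmean _ _) (fun i => hmean _ _) ?_
    intro i j
    simp only [hcv, add_sub_add_right_eq_sub, ← map_sub, U.norm_map]
end
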